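/- For every positive integer n, a composition c = (c_1,…,c_t) of n is a fixed point of the map V if and only if c_{2i-1} = 1 for every odd index 2i−1 ≤ t and c_{2i} is odd and at least 3 for every even index 2i ≤ t. -/

import Mathlib

/-- A composition of `n`: a list of positive integers summing to `n`. -/
def IsComposition (n : ℕ) (l : List ℕ) : Prop :=
  (∀ x ∈ l, 0 < x) ∧ l.sum = n

/-- The image of one pair `(x, y)` of parts under the map `V`:
if `y - x < 1` (i.e. `y ≤ x`) it becomes `(1^{x-y}, 2y)` with the part `2y`
omitted when `y = 0`; otherwise, with the unique `k ≥ 1` such that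
`2k-1 ≤ y-x < 2k+1` (namely `k = (y-x+1)/2`), it becomes
`(1^{x+y-2k-1}, 2k+1)`. -/
def Vstep (x y : ℕ) : List ℕ :=
  if y ≤ x then List.replicate (x - y) 1 ++ (if y = 0 then [] else [2 * y])
  else List.replicate (x + y - 2 * ((y - x + 1) / 2) - 1) 1 ++ [2 * ((y - x + 1) / 2) + 1]

/-- The map `V`: pair up consecutive parts (appending a final `0` when the
length is odd), apply `Vstep` to each pair, and concatenate. -/
def V : List ℕ → List ℕ
  | [] => []
  | [x] => Vstep x 0
  | x :: y :: rest => Vstep x y ++ V rest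

theorem Vstep_zero_right (x : ℕ) : Vstep x 0 = List.replicate x 1 := by
  simp [Vstep]

theorem Vstep_one_of_odd {y : ℕ} (hy : Odd y) (h3 : 3 ≤ y) : Vstep 1 y = [1, y] := by
  obtain ⟨m, rfl⟩ := hy
  have hk : (2 * m + 1 - 1 + 1) / 2 = m := by omega
  have hr : 1 + (2 * m + 1) - 2 * m - 1 = 1 := by omega
  rw [Vstep, if_neg (by omega), hk, hr]
  rfl

theorem Vstep_one_of_even {y : ℕ} (hy : Even y) (h2 : 2 ≤ y) : Vstep 1 y = [y + 1] := by
  obtain ⟨m, rfl⟩ := hy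
  have hk : (m + m - 1 + 1) / 2 = m := by omega
  have hr : 1 + (m + m) - 2 * m - 1 = 0 := by omega
  rw [Vstep, if_neg (by omega), hk, hr, ← two_mul]
  rfl

/-- If `Vstep x y` starts with `x`, then `x = 1`. -/
theorem eq_one_of_Vstep_append_eq_cons {x y : ℕ} (hx : 0 < x) (hy : 0 < y) {l r : List ℕ}
    (h : Vstep x y ++ l = x :: r) : x = 1 := by
  unfold Vstep at h
  split_ifs at h with hyx hy0
  · omega
  · rcases hd : x - y with _ | d
    · simp [hd] at h
      omega
    · simp [hd, List.replicate_succ] at h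
      omega
  · rcases hd : x + y - 2 * ((y - x + 1) / 2) - 1 with _ | d
    · simp [hd] at h
      omega
    · simp only [hd, List.replicate_succ, List.cons_append, List.cons.injEq] at h
      omega

/-- A pair of positive parts at the front of a list is reproduced by `Vstep` only if it is
`(1, y)` with `y` odd and at least `3`. -/
theorem Vstep_append_eq_iff {x y : ℕ} (hx : 0 < x) (hy : 0 < y) (l r : List ℕ) :
    Vstep x y ++ l = x :: y :: r ↔ (x = 1 ∧ Odd y ∧ 3 ≤ y) ∧ l = r := by
  constructor
  · intro h
    obtain rfl := eq_one_of_Vstep_append_eq_cons hx hy h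
    rcases Nat.even_or_odd y with he | ho
    · have h2 : 2 ≤ y := by
        obtain ⟨m, rfl⟩ := he
        omega
      rw [Vstep_one_of_even he h2] at h
      simp at h
      omega
    · by_cases h3 : 3 ≤ y
      · rw [Vstep_one_of_odd ho h3] at h
        exact ⟨⟨rfl, ho, h3⟩, by simpa using h⟩
      · obtain ⟨m, rfl⟩ := ho
        obtain rfl : m = 0 := by omega
        simp [Vstep] at h
  · rintro ⟨⟨rfl, ho, h3⟩, rfl⟩
    rw [Vstep_one_of_odd ho h3]
    rfl

/-- The characterization of the fixed points of `V` among lists of positive integers. -/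
theorem V_eq_self_iff_of_pos (c : List ℕ) (hc : ∀ x ∈ c, 0 < x) :
    V c = c ↔
      (∀ i : ℕ, 2 * i < c.length → c.getD (2 * i) 0 = 1) ∧
      (∀ i : ℕ, 2 * i + 1 < c.length →
        Odd (c.getD (2 * i + 1) 0) ∧ 3 ≤ c.getD (2 * i + 1) 0) := by
  induction c using V.induct with
  | case1 => simp [V]
  | case2 x =>
    rw [V, Vstep_zero_right]
    constructor
    · intro h
      have hx : x = 1 := by simpa using congrArg List.length h
      subst hx
      refine ⟨fun i hi => ?_, fun i hi => ?_⟩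
      · obtain rfl : i = 0 := by simp at hi; omega
        rfl
      · simp at hi
    · rintro ⟨h, -⟩
      obtain rfl : x = 1 := by simpa using h 0 (by simp)
      rfl
  | case3 x y r ih =>
    have hr : ∀ z ∈ r, 0 < z := fun z hz => hc z (by simp [hz])
    rw [V, Vstep_append_eq_iff (hc x (by simp)) (hc y (by simp)), ih hr]
    constructor
    · rintro ⟨⟨h1, hy⟩, ho, he⟩
      refine ⟨fun i hi => ?_, fun i hi => ?_⟩ <;> rcases i with _ | i
      · exact h1
      · exact ho i (by simp at hi; omega)
      · exact hy
      · exact he i (by simp at hi; omega)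
    · rintro ⟨ho, he⟩
      refine ⟨⟨ho 0 (by simp), he 0 (by simp)⟩, fun i hi => ?_, fun i hi => ?_⟩
      · exact ho (i + 1) (by simp; omega)
      · exact he (i + 1) (by simp; omega)

/-- A composition of `n` is fixed by `V` iff every part in an odd position
(1-based) equals `1` and every part in an even position (1-based) is odd and
at least `3`. -/
theorem V_fixed_iff (n : ℕ) (hn : 0 < n) (c : List ℕ) (hc : IsComposition n c) :
    V c = c ↔
      (∀ i : ℕ, 2 * i < c.length → c.getD (2 * i) 0 = 1) ∧
      (∀ i : ℕ, 2 * i + 1 < c.length →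
        Odd (c.getD (2 * i + 1) 0) ∧ 3 ≤ c.getD (2 * i + 1) 0) := by
  exact V_eq_self_iff_of_pos c hc.1
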